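/- arXiv:0708.1253 — 3 statements merged into one kernel-verified Lean document; each statement's English description precedes it below -/
import Mathlib

section
/- Let n ≥ 2, let J be a real diagonal n×n matrix with strictly decreasing diagonal entries J₁ > J₂ > … > J_n, let I be a real diagonal n×n matrix, fix t ∈ ℝ, μ ∈ ℝ and ν > 0, and set z_k(x) = J_k·x + I_k·t. Let n₀ ∈ ℂⁿ have all components nonzero, and define D(x) = Σ_{p=1}^{n} |n₀^p|²·exp(2ν·z_p(x)) > 0 and the matrix P(x) with entries P(x)_{ks} = n₀^k·conj(n₀^s)·exp(−i(μ+iν)·z_k(x) + i(μ−iν)·z_s(x)) / D(x). Then P(x) → E₁₁ as x → +∞ and P(x) → E_{nn} as x → −∞, where E_{kk} denotes the matrix whose only nonzero entry is a 1 in position (k,k). -/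
open Filter

theorem aux_proj {n : ℕ} (J Iv : Fin n → ℝ)
    (t μ ν : ℝ) (hν : 0 < ν)
    (n0 : Fin n → ℂ) (hn0 : ∀ k, n0 k ≠ 0)
    (D : ℝ → ℝ)
    (hD : ∀ x : ℝ, D x =
      ∑ p, ‖n0 p‖ ^ 2 * Real.exp (2 * ν * (J p * x + Iv p * t)))
    (hpos : ∀ x, 0 < D x)
    (P : ℝ → Matrix (Fin n) (Fin n) ℂ)
    (hP : ∀ (x : ℝ) (k s : Fin n), P x k s =
      n0 k * (starRingEnd ℂ) (n0 s) *
        Complex.exp (-Complex.I * ((μ : ℂ) + (ν : ℂ) * Complex.I) * ((J k * x + Iv k * t : ℝ) : ℂ)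
          + Complex.I * ((μ : ℂ) - (ν : ℂ) * Complex.I) * ((J s * x + Iv s * t : ℝ) : ℂ))
        / ((D x : ℝ) : ℂ))
    (l : Filter ℝ) (a : Fin n)
    (hl : ∀ k, k ≠ a → Tendsto (fun x => (J k - J a) * x) l atBot) :
    Tendsto P l (nhds (Matrix.single a a 1)) := by
  have hnp : ∀ k, 0 < ‖n0 k‖ := fun k => norm_pos_iff.mpr (hn0 k)
  set q : Fin n → ℝ → ℝ := fun k x =>
    ‖n0 k‖ ^ 2 * Real.exp (2 * ν * (J k * x + Iv k * t)) / D x with hq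
  have hqnn : ∀ k x, 0 ≤ q k x := fun k x => by
    have := hpos x
    simp only [hq]; positivity
  have hsum : ∀ x, ∑ k, q k x = 1 := fun x => by
    simp only [hq]
    rw [← Finset.sum_div, ← hD, div_self (hpos x).ne']
  have hq0 : ∀ k, k ≠ a → Tendsto (q k) l (nhds 0) := by
    intro k hk
    have h1 : Tendsto (fun x => ‖n0 k‖ ^ 2 / ‖n0 a‖ ^ 2 *
        Real.exp (2 * ν * ((J k - J a) * x + (Iv k - Iv a) * t))) l (nhds 0) := by
      have h2 := Real.tendsto_exp_atBot.comp
        ((tendsto_atBot_add_const_right l ((Iv k - Iv a) * t) (hl k hk)).const_mul_atBot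
          (show 0 < 2 * ν by positivity))
      simpa using h2.const_mul (‖n0 k‖ ^ 2 / ‖n0 a‖ ^ 2)
    refine squeeze_zero (hqnn k) (fun x => ?_) h1
    have hle : ‖n0 a‖ ^ 2 * Real.exp (2 * ν * (J a * x + Iv a * t)) ≤ D x := by
      rw [hD]
      exact Finset.single_le_sum
        (f := fun p => ‖n0 p‖ ^ 2 * Real.exp (2 * ν * (J p * x + Iv p * t)))
        (fun i _ => by positivity) (Finset.mem_univ a)
    have ha := hnp a
    simp only [hq]
    rw [div_le_iff₀ (hpos x)]
    have he : Real.exp (2 * ν * (J k * x + Iv k * t)) =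
        Real.exp (2 * ν * ((J k - J a) * x + (Iv k - Iv a) * t)) *
        Real.exp (2 * ν * (J a * x + Iv a * t)) := by
      rw [← Real.exp_add]; congr 1; ring
    calc ‖n0 k‖ ^ 2 * Real.exp (2 * ν * (J k * x + Iv k * t))
        = ‖n0 k‖ ^ 2 / ‖n0 a‖ ^ 2 *
          Real.exp (2 * ν * ((J k - J a) * x + (Iv k - Iv a) * t)) *
          (‖n0 a‖ ^ 2 * Real.exp (2 * ν * (J a * x + Iv a * t))) := by
          rw [he]; field_simp
      _ ≤ _ := by gcongr
  have hq1 : Tendsto (q a) l (nhds 1) := by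
    have h : q a = fun x => 1 - ∑ k ∈ Finset.univ.erase a, q k x := by
      funext x
      rw [← hsum x, ← Finset.add_sum_erase _ _ (Finset.mem_univ a)]; ring
    rw [h]
    have h3 : Tendsto (fun x => ∑ k ∈ Finset.univ.erase a, q k x) l
        (nhds (∑ k ∈ Finset.univ.erase a, (0 : ℝ))) :=
      tendsto_finsetSum _ (fun k hk => hq0 k (Finset.ne_of_mem_erase hk))
    simpa using h3.const_sub 1
  have hdiag : ∀ k x, P x k k = ((q k x : ℝ) : ℂ) := by
    intro k x
    rw [hP, Complex.mul_conj, Complex.normSq_eq_norm_sq]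
    simp only [hq]
    push_cast
    congr 3
    linear_combination (-2 * (ν : ℂ) * ((J k : ℂ) * x + Iv k * t)) * Complex.I_mul_I
  have hnorm : ∀ k s x, ‖P x k s‖ = Real.sqrt (q k x * q s x) := by
    intro k s x
    symm
    rw [Real.sqrt_eq_iff_mul_self_eq (mul_nonneg (hqnn k x) (hqnn s x)) (norm_nonneg _)]
    rw [hP]
    simp only [hq, norm_mul, norm_div, Complex.norm_exp, RCLike.norm_conj, Complex.norm_real,
      Real.norm_eq_abs, abs_of_pos (hpos x)]
    have hre : (-Complex.I * ((μ : ℂ) + (ν : ℂ) * Complex.I) * ((J k * x + Iv k * t : ℝ) : ℂ)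
          + Complex.I * ((μ : ℂ) - (ν : ℂ) * Complex.I) * ((J s * x + Iv s * t : ℝ) : ℂ)).re
        = ν * (J k * x + Iv k * t) + ν * (J s * x + Iv s * t) := by
      simp [-Complex.ofReal_add, -Complex.ofReal_mul]
    rw [hre, Real.exp_add]
    have h2 : ∀ y : ℝ, Real.exp (2 * ν * y) = Real.exp (ν * y) * Real.exp (ν * y) := fun y => by
      rw [← Real.exp_add]; congr 1; ring
    rw [h2, h2]
    ring
  refine tendsto_pi_nhds.mpr fun k => tendsto_pi_nhds.mpr fun s => ?_
  by_cases hks : k = s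
  · subst hks
    simp only [hdiag]
    by_cases hk : k = a
    · subst hk
      simpa [Function.comp_def] using (Complex.continuous_ofReal.tendsto _).comp hq1
    · have := (Complex.continuous_ofReal.tendsto _).comp (hq0 k hk)
      simpa [Matrix.single_apply, Ne.symm hk, Function.comp_def] using this
  · have hz : Matrix.single a a (1 : ℂ) k s = 0 := by
      rw [Matrix.single_apply, if_neg]
      rintro ⟨rfl, rfl⟩
      exact hks rfl
    rw [hz, tendsto_zero_iff_norm_tendsto_zero]
    simp only [hnorm]
    have hprod : Tendsto (fun x => q k x * q s x) l (nhds 0) := by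
      by_cases hk : k = a
      · subst hk
        simpa using hq1.mul (hq0 s (Ne.symm hks))
      · by_cases hs : s = a
        · subst hs
          simpa using (hq0 k hk).mul hq1
        · simpa using (hq0 k hk).mul (hq0 s hs)
    simpa using hprod.sqrt


/-- asymptotics of the reduced one-soliton projector. With `J` strictly
decreasing, `D(x) = Σ_p |n₀^p|² exp(2ν z_p(x)) > 0` and
`P(x)_{ks} = n₀^k conj(n₀^s) exp(-i(μ+iν)z_k + i(μ-iν)z_s)/D(x)`, one has
`P(x) → E₁₁` as `x → +∞` and `P(x) → E_{nn}` as `x → -∞`. -/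
theorem stmt_11 {n : ℕ} (hn : 2 ≤ n) (J Iv : Fin n → ℝ) (hJ : StrictAnti J)
    (t μ ν : ℝ) (hν : 0 < ν)
    (n0 : Fin n → ℂ) (hn0 : ∀ k, n0 k ≠ 0)
    (D : ℝ → ℝ)
    (hD : ∀ x : ℝ, D x =
      ∑ p, ‖n0 p‖ ^ 2 * Real.exp (2 * ν * (J p * x + Iv p * t)))
    (P : ℝ → Matrix (Fin n) (Fin n) ℂ)
    (hP : ∀ (x : ℝ) (k s : Fin n), P x k s =
      n0 k * (starRingEnd ℂ) (n0 s) *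
        Complex.exp (-Complex.I * ((μ : ℂ) + (ν : ℂ) * Complex.I) * ((J k * x + Iv k * t : ℝ) : ℂ)
          + Complex.I * ((μ : ℂ) - (ν : ℂ) * Complex.I) * ((J s * x + Iv s * t : ℝ) : ℂ))
        / ((D x : ℝ) : ℂ)) :
    (∀ x : ℝ, 0 < D x) ∧
    Tendsto P atTop
      (nhds (Matrix.single (⟨0, by omega⟩ : Fin n) (⟨0, by omega⟩ : Fin n) 1)) ∧
    Tendsto P atBot
      (nhds (Matrix.single (⟨n - 1, by omega⟩ : Fin n) (⟨n - 1, by omega⟩ : Fin n) 1)) := by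
  have hpos : ∀ x : ℝ, 0 < D x := by
    intro x
    rw [hD]
    refine Finset.sum_pos (fun p _ => ?_) ⟨⟨0, by omega⟩, Finset.mem_univ _⟩
    have := norm_pos_iff.mpr (hn0 p)
    positivity
  refine ⟨hpos, ?_, ?_⟩
  · refine aux_proj J Iv t μ ν hν n0 hn0 D hD hpos P hP atTop _ (fun k hk => ?_)
    refine tendsto_id.const_mul_atTop_of_neg (sub_neg.mpr (hJ ?_))
    rw [Fin.lt_def]
    have : k.val ≠ 0 := fun h => hk (Fin.ext h)
    simp only
    omega
  · refine aux_proj J Iv t μ ν hν n0 hn0 D hD hpos P hP atBot _ (fun k hk => ?_)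
    refine tendsto_id.const_mul_atBot (sub_pos.mpr (hJ ?_))
    rw [Fin.lt_def]
    have : k.val ≠ n - 1 := fun h => hk (Fin.ext h)
    simp only
    omega
end

section
/- Let n ≥ 2, let J and I be real diagonal n×n matrices, μ ∈ ℝ, ν > 0, and set z_k(x,t) = J_k·x + I_k·t. Let n₀ ∈ ℂⁿ, n₀ ≠ 0, and define D(x,t) = Σ_{p=1}^{n} |n₀^p|²·exp(2ν·z_p(x,t)) and, for k ≠ s, q_{ks}(x,t) = −2iν·(J_k − J_s)·n₀^k·conj(n₀^s)·exp(ν(z_k + z_s))·exp(−iμ(z_k − z_s)) / D(x,t). Then D(x,t) > 0 for all (x,t) and |q_{ks}(x,t)| ≤ ν·|J_k − J_s| for all (x,t) ∈ ℝ² and all k ≠ s; in particular the reduced one-soliton solution is a regular (nonsingular) bounded function on ℝ². -/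
/-- boundedness/regularity of the reduced one-soliton of the N-wave
system: `D(x,t) = Σ_p |n₀^p|² exp(2ν z_p) > 0` and the entries
`q_{ks} = -2iν(J_k - J_s) n₀^k conj(n₀^s) e^{ν(z_k+z_s)} e^{-iμ(z_k-z_s)} / D`
satisfy `|q_{ks}(x,t)| ≤ ν |J_k - J_s|` everywhere. -/
theorem stmt_12 {n : ℕ} (hn : 2 ≤ n) (J Iv : Fin n → ℝ) (μ ν : ℝ) (hν : 0 < ν)
    (n0 : Fin n → ℂ) (hn0 : n0 ≠ 0)
    (D : ℝ → ℝ → ℝ)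
    (hD : ∀ x t : ℝ, D x t =
      ∑ p, ‖n0 p‖ ^ 2 * Real.exp (2 * ν * (J p * x + Iv p * t)))
    (q : ℝ → ℝ → Matrix (Fin n) (Fin n) ℂ)
    (hq : ∀ (x t : ℝ) (k s : Fin n), q x t k s =
      -2 * Complex.I * (ν : ℂ) * ((J k - J s : ℝ) : ℂ) * n0 k * (starRingEnd ℂ) (n0 s)
        * Complex.exp (((ν * ((J k * x + Iv k * t) + (J s * x + Iv s * t)) : ℝ) : ℂ))
        * Complex.exp (-Complex.I * ((μ * ((J k * x + Iv k * t) - (J s * x + Iv s * t)) : ℝ) : ℂ))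
        / ((D x t : ℝ) : ℂ)) :
    (∀ x t : ℝ, 0 < D x t) ∧
    (∀ (x t : ℝ) (k s : Fin n), k ≠ s →
      ‖q x t k s‖ ≤ ν * |J k - J s|) := by
  have hpos : ∀ x t : ℝ, 0 < D x t := by
    intro x t
    rw [hD]
    obtain ⟨p, hp⟩ := Function.ne_iff.mp hn0
    have hp' : 0 < ‖n0 p‖ := norm_pos_iff.mpr hp
    exact Finset.sum_pos' (fun i _ => by positivity) ⟨p, Finset.mem_univ p, by positivity⟩
  refine ⟨hpos, ?_⟩
  intro x t k s hks
  have hDp := hpos x t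
  set a := J k * x + Iv k * t with ha
  set b := J s * x + Iv s * t with hb
  have hE : ‖Complex.exp (-Complex.I * ((μ * (a - b) : ℝ) : ℂ))‖ = 1 := by
    rw [Complex.norm_exp]
    simp
  have hE2 : ‖Complex.exp (((ν * (a + b) : ℝ) : ℂ))‖ = Real.exp (ν * a) * Real.exp (ν * b) := by
    rw [Complex.norm_exp, Complex.ofReal_re, ← Real.exp_add]
    ring_nf
  have hle : (‖n0 k‖ * Real.exp (ν * a)) ^ 2 + (‖n0 s‖ * Real.exp (ν * b)) ^ 2 ≤ D x t := by
    rw [hD, ← Finset.add_sum_erase _ _ (Finset.mem_univ k)]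
    have h1 := Finset.single_le_sum (s := Finset.univ.erase k)
      (f := fun p => ‖n0 p‖ ^ 2 * Real.exp (2 * ν * (J p * x + Iv p * t)))
      (fun i _ => by positivity) (Finset.mem_erase.mpr ⟨hks.symm, Finset.mem_univ s⟩)
    have hsq : ∀ c : ℝ, Real.exp (2 * ν * c) = Real.exp (ν * c) ^ 2 := by
      intro c
      rw [sq, ← Real.exp_add]
      ring_nf
    simp only [← ha, ← hb, hsq, mul_pow] at h1 ⊢
    linarith
  have h2 : 2 * (‖n0 k‖ * Real.exp (ν * a)) * (‖n0 s‖ * Real.exp (ν * b)) ≤ D x t :=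
    (two_mul_le_add_sq _ _).trans hle
  rw [hq, ← ha, ← hb, norm_div, norm_mul, hE, norm_mul, hE2]
  simp only [norm_mul, norm_neg, Complex.norm_I, Complex.norm_real, RCLike.norm_conj,
    Complex.norm_ofNat, Real.norm_eq_abs, abs_of_pos hν, abs_of_pos hDp]
  rw [div_le_iff₀ hDp]
  have h3 := mul_le_mul_of_nonneg_left h2 (by positivity : 0 ≤ ν * |J k - J s|)
  refine le_trans (le_of_eq ?_) h3
  ring
end

section
/- Let J = diag(J₁,…,J₅) and I = diag(I₁,…,I₅) be real diagonal 5×5 matrices with J₁ > J₂ > J₃ > 0 > J₄ > J₅. Fix t ∈ ℝ, μ ∈ ℝ, ν > 0, set λ⁺ = μ + iν and z_k(x) = J_k·x + I_k·t. Let n₀ ∈ ℂ⁵, n₀ ≠ 0, define D(x) = Σ_{p=1}^{5} |n₀^p|²·exp(2ν·z_p(x)) and the matrix P(x) with entries P(x)_{ks} = n₀^k·conj(n₀^s)·exp(−iλ⁺·z_k(x) + i·conj(λ⁺)·z_s(x)) / D(x). Let d₀ ∈ ℂ⁵ be the vector with (d₀)_k = (n₀)_k for k ∈ {4,5} and (d₀)_k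 = 0 for k ∈ {1,2,3}, let v(x) ∈ ℂ⁵ have components v(x)_k = exp(−iλ⁺·z_k(x))·(d₀)_k, and set f(x) = (1 − P(x))·v(x). Then: (i) for every a with 0 < a < −J₄, exp(νax)·f(x) → 0 as x → +∞; and (ii) for every b with 0 < b < J₃, exp(−νbx)·f(x) → 0 as x → −∞. In particular f decreases exponentially in both directions. -/
open Filter

lemma aux_bdd (l : Filter ℝ) (P : ℝ → Matrix (Fin 5) (Fin 5) ℂ) (hP : ∀ x k s, ‖P x k s‖ ≤ 1)
    (u : ℝ → Fin 5 → ℂ) (hu : ∀ k, Tendsto (fun x => u x k) l (nhds 0)) :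
    Tendsto (fun x => (1 - P x).mulVec (u x)) l (nhds 0) := by
  rw [tendsto_pi_nhds]
  intro k
  have h1 : ∀ s, Tendsto (fun x => P x k s * u x s) l (nhds 0) := by
    intro s
    refine squeeze_zero_norm (fun x => ?_) (by simpa using (hu s).norm)
    rw [norm_mul]
    have := mul_le_mul_of_nonneg_right (hP x k s) (norm_nonneg (u x s))
    linarith
  have h2 := (hu k).sub (tendsto_finsetSum Finset.univ (fun s _ => h1 s))
  simp only [Finset.sum_const_zero, sub_zero] at h2
  refine h2.congr fun x => ?_
  rw [Matrix.sub_mulVec, Matrix.one_mulVec]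
  rfl

lemma aux_norm (μ ν z : ℝ) :
    ‖Complex.exp (-Complex.I * ((μ : ℂ) + (ν : ℂ) * Complex.I) * (z : ℂ))‖ = Real.exp (ν * z) := by
  rw [Complex.norm_exp]
  congr 1
  simp

lemma aux_conj (μ ν z : ℝ) :
    Complex.exp (Complex.I * ((starRingEnd ℂ) ((μ : ℂ) + (ν : ℂ) * Complex.I)) * (z : ℂ))
    = (starRingEnd ℂ) (Complex.exp (-Complex.I * ((μ : ℂ) + (ν : ℂ) * Complex.I) * (z : ℂ))) := by
  rw [← Complex.exp_conj]
  congr 1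
  simp

lemma aux_P (w : Fin 5 → ℂ) (D : ℝ) (hD : D = ∑ p, ‖w p‖ ^ 2) (k s : Fin 5) :
    ‖w k * (starRingEnd ℂ) (w s) / (D : ℂ)‖ ≤ 1 := by
  have hk : ‖w k‖ ^ 2 ≤ D := hD ▸ Finset.single_le_sum (f := fun p => ‖w p‖ ^ 2)
    (fun _ _ => by positivity) (Finset.mem_univ k)
  have hs : ‖w s‖ ^ 2 ≤ D := hD ▸ Finset.single_le_sum (f := fun p => ‖w p‖ ^ 2)
    (fun _ _ => by positivity) (Finset.mem_univ s)
  have h0 : 0 ≤ D := le_trans (by positivity) hk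
  rw [norm_div, norm_mul, RCLike.norm_conj, Complex.norm_real, Real.norm_of_nonneg h0]
  apply div_le_one_of_le₀ _ h0
  nlinarith [sq_nonneg (‖w k‖ - ‖w s‖)]

lemma aux_exp_top (c C : ℝ) (hc : c < 0) :
    Tendsto (fun x : ℝ => Real.exp (c * x) * C) atTop (nhds 0) := by
  have := (Real.tendsto_exp_atBot.comp
    ((tendsto_const_mul_atBot_of_neg hc).2 tendsto_id)).mul_const C
  simpa using this

lemma aux_exp_bot (c C : ℝ) (hc : 0 < c) :
    Tendsto (fun x : ℝ => Real.exp (c * x) * C) atBot (nhds 0) := by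
  have := (Real.tendsto_exp_atBot.comp
    ((tendsto_const_mul_atBot_of_pos hc).2 tendsto_id)).mul_const C
  simpa using this

/-- exponential decay in both directions of the dressed discrete
eigenfunction `f(x) = (1 - P(x))·v(x)` built from the part `d₀` of the polarization
vector supported on the indices where `J` is negative. -/
theorem stmt_14 (J Iv : Fin 5 → ℝ)
    (hJ : J 0 > J 1 ∧ J 1 > J 2 ∧ J 2 > 0 ∧ (0 : ℝ) > J 3 ∧ J 3 > J 4)
    (t μ ν : ℝ) (hν : 0 < ν)
    (n0 : Fin 5 → ℂ) (hn0 : n0 ≠ 0)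
    (D : ℝ → ℝ)
    (hD : ∀ x : ℝ, D x =
      ∑ p, ‖n0 p‖ ^ 2 * Real.exp (2 * ν * (J p * x + Iv p * t)))
    (P : ℝ → Matrix (Fin 5) (Fin 5) ℂ)
    (hP : ∀ (x : ℝ) (k s : Fin 5), P x k s =
      n0 k * (starRingEnd ℂ) (n0 s) *
        Complex.exp (-Complex.I * ((μ : ℂ) + (ν : ℂ) * Complex.I) * ((J k * x + Iv k * t : ℝ) : ℂ)
          + Complex.I * ((starRingEnd ℂ) ((μ : ℂ) + (ν : ℂ) * Complex.I)) * ((J s * x + Iv s * t : ℝ) : ℂ))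
        / ((D x : ℝ) : ℂ))
    (d0 : Fin 5 → ℂ) (hd0 : d0 = fun k => if k = 3 ∨ k = 4 then n0 k else 0)
    (f : ℝ → Fin 5 → ℂ)
    (hf : ∀ x : ℝ, f x = (1 - P x).mulVec
      (fun k => Complex.exp (-Complex.I * ((μ : ℂ) + (ν : ℂ) * Complex.I) *
          ((J k * x + Iv k * t : ℝ) : ℂ)) * d0 k)) :
    (∀ a : ℝ, 0 < a → a < -J 3 →
      Tendsto (fun x : ℝ => Real.exp (ν * a * x) • f x) atTop (nhds 0)) ∧
    (∀ b : ℝ, 0 < b → b < J 2 →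
      Tendsto (fun x : ℝ => Real.exp (-(ν * b * x)) • f x) atBot (nhds 0)) := by
  obtain ⟨h01, h12, h2, h3, h34⟩ := hJ
  set e : ℝ → Fin 5 → ℂ := fun x k => Complex.exp (-Complex.I *
    ((μ : ℂ) + (ν : ℂ) * Complex.I) * ((J k * x + Iv k * t : ℝ) : ℂ)) with he
  have hen : ∀ x k, ‖e x k‖ = Real.exp (ν * (J k * x + Iv k * t)) := fun x k => aux_norm _ _ _
  have hD' : ∀ x, D x = ∑ p, ‖e x p * n0 p‖ ^ 2 := by
    intro x
    rw [hD]
    refine Finset.sum_congr rfl fun p _ => ?_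
    rw [norm_mul, hen, mul_pow, ← Real.exp_nat_mul, mul_comm]
    congr 2
    push_cast
    ring
  have hP' : ∀ x k s, P x k s =
      (e x k * n0 k) * (starRingEnd ℂ) (e x s * n0 s) / (D x : ℂ) := by
    intro x k s
    rw [hP, Complex.exp_add, aux_conj, map_mul]
    simp only [he]
    ring
  have hPb : ∀ x k s, ‖P x k s‖ ≤ 1 := by
    intro x k s
    rw [hP']
    exact aux_P (fun p => e x p * n0 p) _ (hD' x) k s
  have hDpos : ∀ x, D x ≠ 0 := by
    intro x h
    rw [hD', Finset.sum_eq_zero_iff_of_nonneg (fun _ _ => by positivity)] at h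
    apply hn0
    funext k
    have := h k (Finset.mem_univ k)
    simpa [he] using this
  have hker : ∀ x, (1 - P x).mulVec (fun k => e x k * n0 k) = 0 := by
    intro x
    rw [Matrix.sub_mulVec, Matrix.one_mulVec, sub_eq_zero]
    funext k
    have hd : (D x : ℂ) ≠ 0 := by exact_mod_cast hDpos x
    have hs : (D x : ℂ) = ∑ s, (starRingEnd ℂ) (e x s * n0 s) * (e x s * n0 s) := by
      rw [hD']
      push_cast
      exact Finset.sum_congr rfl fun s _ => by rw [Complex.conj_mul']
    have : (P x).mulVec (fun k => e x k * n0 k) k = (e x k * n0 k) / (D x : ℂ) *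
        ∑ s, (starRingEnd ℂ) (e x s * n0 s) * (e x s * n0 s) := by
      rw [Finset.mul_sum]
      simp only [Matrix.mulVec, dotProduct]
      refine Finset.sum_congr rfl fun s _ => ?_
      rw [hP']
      ring
    rw [this, ← hs, div_mul_cancel₀ _ hd]
  have hf2 : ∀ x, f x = (1 - P x).mulVec (fun k => e x k * (d0 k - n0 k)) := by
    intro x
    have h : (fun k => e x k * (d0 k - n0 k))
        = (fun k => e x k * d0 k) - (fun k => e x k * n0 k) := by
      funext k
      simp [mul_sub]
    rw [h, Matrix.mulVec_sub, hker, sub_zero, hf]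
  have hnorm : ∀ (c x : ℝ) (k : Fin 5) (q : ℂ), ‖(Real.exp (ν * c * x)) • (e x k * q)‖ =
      Real.exp (ν * (c + J k) * x) * (Real.exp (ν * (Iv k * t)) * ‖q‖) := by
    intro c x k q
    rw [norm_smul, norm_mul, hen, Real.norm_of_nonneg (Real.exp_pos _).le, ← mul_assoc,
      ← mul_assoc, ← Real.exp_add, ← Real.exp_add]
    congr 2
    ring
  constructor
  · intro a ha ha'
    have key := aux_bdd atTop P hPb (fun x => Real.exp (ν * a * x) • (fun k => e x k * d0 k)) ?_
    · refine key.congr fun x => ?_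
      rw [Matrix.mulVec_smul, hf]
    · intro k
      rw [tendsto_zero_iff_norm_tendsto_zero]
      simp only [Pi.smul_apply, hnorm]
      by_cases hk : k = 3 ∨ k = 4
      · apply aux_exp_top
        apply mul_neg_of_pos_of_neg hν
        rcases hk with rfl | rfl <;> linarith
      · simp [hd0, hk]
  · intro b hb hb'
    have key := aux_bdd atBot P hPb
      (fun x => Real.exp (ν * (-b) * x) • (fun k => e x k * (d0 k - n0 k))) ?_
    · refine key.congr fun x => ?_
      rw [Matrix.mulVec_smul, ← hf2]
      congr 2
      ring
    · intro k
      rw [tendsto_zero_iff_norm_tendsto_zero]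
      simp only [Pi.smul_apply, hnorm]
      by_cases hk : k = 3 ∨ k = 4
      · simp [hd0, hk]
      · apply aux_exp_bot
        apply mul_pos hν
        fin_cases k <;> simp at hk ⊢ <;> linarith
end
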